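/- Let A be an n×n complex matrix whose characteristic polynomial over ℂ factors as ∏_{i=1}^n (X − λ_i) with the eigenvalues ordered so that |λ_1| ≥ |λ_2| ≥ … ≥ |λ_n|, and let s < n. Suppose u_1,…,u_s ∈ ℂ^n are linearly independent right eigenvectors (A u_i = λ_i u_i) and v_1,…,v_s ∈ ℂ^n are arbitrary vectors (not necessarily left eigenvectors) satisfying v_iᴴ u_i = 1 and v_iᴴ u_j = 0 for all 1 ≤ i ≠ j ≤ s. Then the deflated matrix A − E_s, where E_s = ∑_{i=1}^s λ_i u_i v_iᴴ, has spectral radius equal to |λ_{s+1}| (Wielandt's deflation). -/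

import Mathlib

open Matrix Polynomial

/-- If `B * E = 0`, the characteristic matrices of `B` and `E` multiply to `X` times that of
`B + E`. -/
theorem Matrix.charpoly_mul_charpoly_of_mul_eq_zero {R m : Type*} [CommRing R] [Fintype m]
    [DecidableEq m] {B E : Matrix m m R} (h : B * E = 0) :
    B.charpoly * E.charpoly = X ^ Fintype.card m * (B + E).charpoly := by
  have hBE : C.mapMatrix B * C.mapMatrix E = 0 := by rw [← map_mul, h, map_zero]
  have hmul : B.charmatrix * E.charmatrix = (X : R[X]) • (B + E).charmatrix := by
    have hscalar (M : Matrix m m R[X]) : scalar m (X : R[X]) * M = (X : R[X]) • M := by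
      simp [← smul_eq_diagonal_mul]
    have hcomm : C.mapMatrix B * scalar m (X : R[X]) = scalar m (X : R[X]) * C.mapMatrix B :=
      (scalar_commute _ (Commute.all _) _).symm.eq
    rw [← hscalar]
    simp only [charmatrix, map_add, sub_mul, mul_sub, mul_add, hBE, hcomm]
    abel
  rw [charpoly, charpoly, charpoly, ← det_mul, hmul, det_smul]

/-- Deflating by `U * L * V`, where `V * U = 1` and `A * U = U * L`, replaces the
characteristic polynomial of `L` by a power of `X`. -/
theorem Matrix.charpoly_sub_mul_charpoly {R m k : Type*} [CommRing R] [Fintype m]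
    [DecidableEq m] [Fintype k] [DecidableEq k] {A : Matrix m m R} {U : Matrix m k R}
    {V : Matrix k m R} {L : Matrix k k R} (hVU : V * U = 1) (hAU : A * U = U * L) :
    (A - U * L * V).charpoly * L.charpoly = X ^ Fintype.card k * A.charpoly := by
  have hzero : (A - U * L * V) * (U * L * V) = 0 := by
    have hU : (A - U * L * V) * U = 0 := by
      rw [Matrix.sub_mul, Matrix.mul_assoc (U * L), hVU, Matrix.mul_one, hAU, sub_self]
    rw [Matrix.mul_assoc U, ← Matrix.mul_assoc, ← Matrix.mul_assoc U, hU, Matrix.zero_mul]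
  have hprod := charpoly_mul_charpoly_of_mul_eq_zero hzero
  rw [sub_add_cancel] at hprod
  have hcomm := charpoly_mul_comm' U (L * V)
  rw [Matrix.mul_assoc L, hVU, Matrix.mul_one, ← Matrix.mul_assoc] at hcomm
  apply (monic_X_pow (R := R) (Fintype.card m)).isRegular.left
  simp only
  linear_combination (X ^ Fintype.card k : R[X]) * hprod - (A - U * L * V).charpoly * hcomm

/-- **Wielandt's deflation.** If `A` has characteristic polynomial `∏ (X - λᵢ)` with
eigenvalues ordered by decreasing magnitude, `u₁,…,u_s` are linearly independent right
eigenvectors for the top `s` eigenvalues, and `v₁,…,v_s` are arbitrary vectors with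
`vᵢᴴ uⱼ = δᵢⱼ`, then the deflated matrix `A - Eₛ` with `Eₛ = ∑ λᵢ uᵢ vᵢᴴ` has spectral
radius `|λ_{s+1}|`. -/
theorem wielandt_deflation {n : ℕ} (A : Matrix (Fin n) (Fin n) ℂ)
    (lam : Fin n → ℂ)
    (hchar : A.charpoly = ∏ i : Fin n, (X - C (lam i)))
    (hord : ∀ i j : Fin n, i ≤ j → ‖lam j‖ ≤ ‖lam i‖)
    (s : ℕ) (hs : s < n)
    (u v : Fin s → Fin n → ℂ)
    (hu_indep : LinearIndependent ℂ u)
    (hu : ∀ i : Fin s, A.mulVec (u i) = lam (Fin.castLE hs.le i) • u i)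
    (hbi : ∀ i j : Fin s, star (v i) ⬝ᵥ u j = if i = j then 1 else 0)
    (E : Matrix (Fin n) (Fin n) ℂ)
    (hE : E = ∑ i : Fin s, lam (Fin.castLE hs.le i) • vecMulVec (u i) (star (v i))) :
    spectralRadius ℂ (A - E) = (‖lam ⟨s, hs⟩‖₊ : ENNReal) := by
  obtain ⟨k, rfl⟩ := Nat.exists_eq_add_of_le hs.le
  set U : Matrix (Fin (s + k)) (Fin s) ℂ := Matrix.of fun a i => u i a
  set V : Matrix (Fin s) (Fin (s + k)) ℂ := Matrix.of fun i => star (v i)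
  set L : Matrix (Fin s) (Fin s) ℂ := diagonal fun i => lam (Fin.castAdd k i) with hLdef
  have hVU : V * U = 1 := by
    ext i j
    rw [one_apply, ← hbi]
    rfl
  have hAU : A * U = U * L := by
    ext a i
    rw [hLdef, mul_diagonal]
    exact (congrFun (hu i) a).trans (mul_comm _ _)
  have hEUV : E = U * L * V := by
    ext a b
    rw [hE, Matrix.sum_apply, mul_apply]
    refine Finset.sum_congr rfl fun i _ => ?_
    rw [hLdef, mul_diagonal, Matrix.smul_apply, vecMulVec_apply, smul_eq_mul, ← mul_assoc,
      mul_comm (lam _)]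
    rfl
  have hdeflated : (A - E).charpoly = X ^ s * ∏ j : Fin k, (X - C (lam (Fin.natAdd s j))) := by
    have hmul := charpoly_sub_mul_charpoly hVU hAU
    rw [← hEUV, hchar, Fin.prod_univ_add, hLdef, charpoly_diagonal, Fintype.card_fin] at hmul
    have hne : ∏ i : Fin s, (X - C (lam (Fin.castAdd k i))) ≠ 0 :=
      (monic_prod_X_sub_C _ _).ne_zero
    exact mul_right_cancel₀ hne (by linear_combination hmul)
  have hspec (z : ℂ) : z ∈ spectrum ℂ (A - E) ↔
      (z = 0 ∧ s ≠ 0) ∨ ∃ j : Fin k, z = lam (Fin.natAdd s j) := by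
    rw [mem_spectrum_iff_isRoot_charpoly, hdeflated, IsRoot.def, eval_mul, mul_eq_zero,
      eval_prod, Finset.prod_eq_zero_iff]
    simp [sub_eq_zero]
  apply le_antisymm
  · refine iSup₂_le fun z hz => ?_
    rcases (hspec z).1 hz with ⟨rfl, -⟩ | ⟨j, rfl⟩
    · simp
    · exact_mod_cast hord ⟨s, hs⟩ (Fin.natAdd s j) (Fin.le_def.2 (by simp))
  · exact le_iSup₂ (f := fun z (_ : z ∈ spectrum ℂ (A - E)) => (‖z‖₊ : ENNReal)) (lam ⟨s, hs⟩)
      ((hspec _).2 (Or.inr ⟨⟨0, by lia⟩, rfl⟩))
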